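/- Let F_1, …, F_r be k-uniform hypergraphs such that F_2 has at least three edges, m_k(F_1) ≥ m_k(F_2) ≥ … ≥ m_k(F_r) > 0, and: (i) F_1 and F_2 are strictly k-balanced and m_k(F_2) ≥ 1; (ii) F_1 is strictly balanced with respect to m_k(·, F_2); (iii) the family F*(F_1,F_2) is asymmetric-balanced; (iv) every k-uniform hypergraph G with m(G) ≤ m_k(F_1,F_2) satisfies G ↛ (F_1, F_2). Then there exists a constant c > 0 such that for p ≤ c·n^{-1/m_k(F_1,F_2)}, the probability that H^k(n,p) → (F_1, …, F_r) tends to 0 as n → ∞. -/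

import Mathlib

open scoped Classical

namespace ARR

/-- The vertex support of a hypergraph given by its edge set. -/
def vset (G : Finset (Finset ℕ)) : Finset ℕ := G.sup id

/-- Number of vertices of a hypergraph. -/
def vcount (G : Finset (Finset ℕ)) : ℕ := (vset G).card

/-- `G` is a `k`-uniform hypergraph. -/
def IsUniform (k : ℕ) (G : Finset (Finset ℕ)) : Prop := ∀ e ∈ G, e.card = k

/-- The `k`-density `d_k`. -/
noncomputable def dk (k : ℕ) (G : Finset (Finset ℕ)) : ℝ :=
  if G.card = 0 then 0
  else if G.card = 1 ∧ vcount G = k then 1 / (k : ℝ)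
  else ((G.card : ℝ) - 1) / ((vcount G : ℝ) - (k : ℝ))

/-- The `k`-density `m_k`: the maximum of `d_k` over subgraphs. -/
noncomputable def mk (k : ℕ) (G : Finset (Finset ℕ)) : ℝ :=
  sSup {x : ℝ | ∃ H ⊆ G, x = dk k H}

/-- The usual density `m(G)`. -/
noncomputable def mDens (G : Finset (Finset ℕ)) : ℝ :=
  sSup {x : ℝ | ∃ H ⊆ G, 1 ≤ vcount H ∧ x = (H.card : ℝ) / (vcount H : ℝ)}

/-- `G` is strictly `k`-balanced: every proper subgraph has strictly smaller `k`-density. -/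
def StrictlyKBalanced (k : ℕ) (G : Finset (Finset ℕ)) : Prop :=
  ∀ H ⊆ G, H ≠ G → dk k H < dk k G

/-- The asymmetric `k`-density `m_k(F₁,F₂)`. -/
noncomputable def mkA (k : ℕ) (F1 F2 : Finset (Finset ℕ)) : ℝ :=
  sSup {x : ℝ | ∃ H ⊆ F1, H.Nonempty ∧
    x = (H.card : ℝ) / ((vcount H : ℝ) - (k : ℝ) + 1 / mk k F2)}

/-- `F₁` is strictly balanced with respect to `m_k(·, F₂)`. -/
def StrictlyBalancedWrt (k : ℕ) (F1 F2 : Finset (Finset ℕ)) : Prop :=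
  ∀ H ⊆ F1, H.Nonempty → H ≠ F1 →
    (H.card : ℝ) / ((vcount H : ℝ) - (k : ℝ) + 1 / mk k F2) < mkA k F1 F2

/-- `F'` is a copy of `F` (an isomorphic image of `F`). -/
def IsCopy (F F' : Finset (Finset ℕ)) : Prop :=
  ∃ f : ℕ → ℕ, Set.InjOn f ↑(vset F) ∧ F' = F.image (Finset.image f)

/-- `G` contains a copy of `F`. -/
def ContainsCopy (G F : Finset (Finset ℕ)) : Prop := ∃ F' ⊆ G, IsCopy F F'

/-- Asymmetric Ramsey arrow `G → (F₁, …, F_r)`. -/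
def Arrow {r : ℕ} (G : Finset (Finset ℕ)) (F : Fin r → Finset (Finset ℕ)) : Prop :=
  ∀ χ : Finset ℕ → Fin r, ∃ i : Fin r, ∃ F' ⊆ G, IsCopy (F i) F' ∧ ∀ e ∈ F', χ e = i

/-- Symmetric Ramsey arrow `G → (F)_r`. -/
def ArrowSym (G F : Finset (Finset ℕ)) (r : ℕ) : Prop :=
  ∀ χ : Finset ℕ → Fin r, ∃ i : Fin r, ∃ F' ⊆ G, IsCopy F F' ∧ ∀ e ∈ F', χ e = i

/-- Two-colour asymmetric arrow `G → (F₁, F₂)`. -/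
def Arrow2 (G F1 F2 : Finset (Finset ℕ)) : Prop :=
  ∀ χ : Finset ℕ → Fin 2,
    (∃ F' ⊆ G, IsCopy F1 F' ∧ ∀ e ∈ F', χ e = 0) ∨
    (∃ F' ⊆ G, IsCopy F2 F' ∧ ∀ e ∈ F', χ e = 1)

/-- The edge set of the complete `k`-uniform hypergraph on `{0, …, n-1}`. -/
def allEdges (k n : ℕ) : Finset (Finset ℕ) := (Finset.range n).powersetCard k

/-- Probability that the binomial random hypergraph `H^k(n,p)` satisfies property `P`. -/
noncomputable def prob (k n : ℕ) (p : ℝ) (P : Finset (Finset ℕ) → Prop) : ℝ :=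
  ∑ G ∈ (allEdges k n).powerset,
    if P G then p ^ G.card * (1 - p) ^ ((allEdges k n).card - G.card) else 0

/-- Expected number of members of a family `𝓕` which appear as subgraphs of `H^k(n,p)`. -/
noncomputable def expectCount (k n : ℕ) (p : ℝ) (𝓕 : Finset (Finset (Finset ℕ))) : ℝ :=
  ∑ G ∈ (allEdges k n).powerset,
    (p ^ G.card * (1 - p) ^ ((allEdges k n).card - G.card)) *
      ((𝓕.filter (fun F => F ⊆ G)).card : ℝ)

/-- `K₃^{+k}`: the triangle on `{0,1,2}` with the `k-2` vertices `{3,…,k}` added to each edge. -/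
def K3plus (k : ℕ) : Finset (Finset ℕ) :=
  {({0, 1} : Finset ℕ) ∪ (Finset.range (k + 1)).filter (fun x => 3 ≤ x),
   ({0, 2} : Finset ℕ) ∪ (Finset.range (k + 1)).filter (fun x => 3 ≤ x),
   ({1, 2} : Finset ℕ) ∪ (Finset.range (k + 1)).filter (fun x => 3 ≤ x)}

/-- The `i`-th edge `{i, i+1, …, i+k-1}` (mod `t`) of the tight cycle on `t` vertices. -/
def cycEdge (k t i : ℕ) : Finset ℕ := (Finset.range k).image (fun j => (i + j) % t)

/-- The tight cycle `C_t` (k-uniform) on vertex set `{0, …, t-1}`. -/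
def tightCycle (k t : ℕ) : Finset (Finset ℕ) := (Finset.range t).image (cycEdge k t)

/-- The tight path `T^k_ℓ` on vertex set `{0, …, ℓ-1}`. -/
def tightPath (k l : ℕ) : Finset (Finset ℕ) :=
  (Finset.range (l - k + 1)).image (fun i => (Finset.range k).image (fun j => i + j))

/-- The cycle length `t_k`: `t₄ = 8`, `t₅ = 14`, and `t_k = k²` for `k ≥ 6`. -/
def tk (k : ℕ) : ℕ := if k = 4 then 8 else if k = 5 then 14 else k ^ 2

/-- Shift all vertices of a hypergraph by `a` (used to form vertex-disjoint unions). -/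
def shiftHG (a : ℕ) (G : Finset (Finset ℕ)) : Finset (Finset ℕ) :=
  G.image (Finset.image (· + a))

/-- A set of edges is `m`-intersecting if any two distinct edges meet in at most `m` vertices. -/
def IntersectingLE (m : ℕ) (S : Finset (Finset ℕ)) : Prop :=
  ∀ e ∈ S, ∀ f ∈ S, e ≠ f → (e ∩ f).card ≤ m

/-- `e₀` is an attachment edge of `Fst` as a member of the family `F*(F₁,F₂)`. -/
def IsAttachment (F1 F2 Fst : Finset (Finset ℕ)) (e0 : Finset ℕ) : Prop :=
  ∃ F2' : Finset (Finset ℕ), e0 ∈ F2' ∧ IsCopy F2 F2' ∧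
    ∃ g : Finset ℕ → Finset (Finset ℕ),
      (∀ e ∈ F2'.erase e0, IsCopy F1 (g e) ∧ e ∈ g e) ∧
      Fst = F2' ∪ (F2'.erase e0).biUnion g

/-- `Fst` is a member of the family `F*(F₁,F₂)`. -/
def IsFStar (F1 F2 Fst : Finset (Finset ℕ)) : Prop := ∃ e0, IsAttachment F1 F2 Fst e0

/-- `Fst` is a generic member of `F*(F₁,F₂)`. -/
def IsGeneric (F1 F2 Fst : Finset (Finset ℕ)) : Prop :=
  ∃ F2' : Finset (Finset ℕ), ∃ e0 ∈ F2', IsCopy F2 F2' ∧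
    ∃ g : Finset ℕ → Finset (Finset ℕ),
      (∀ e ∈ F2'.erase e0, IsCopy F1 (g e) ∧ e ∈ g e) ∧
      Fst = F2' ∪ (F2'.erase e0).biUnion g ∧
      (∀ e ∈ F2'.erase e0, vset (g e) ∩ vset F2' = e) ∧
      (∀ e ∈ F2'.erase e0, ∀ e' ∈ F2'.erase e0, e ≠ e' →
        (vset (g e) \ e) ∩ (vset (g e') \ e') = ∅)

/-- The family `F*(F₁,F₂)` is asymmetric-balanced. -/
def AsymBalanced (k : ℕ) (F1 F2 : Finset (Finset ℕ)) : Prop :=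
  ∀ Fst, IsFStar F1 F2 Fst →
    ∀ H ⊆ Fst, vset H ⊂ vset Fst → (∃ e0 ∈ H, IsAttachment F1 F2 Fst e0) →
      mkA k F1 F2 ≤ ((Fst.card : ℝ) - (H.card : ℝ)) / ((vcount Fst : ℝ) - (vcount H : ℝ)) ∧
      (((Fst.card : ℝ) - (H.card : ℝ)) / ((vcount Fst : ℝ) - (vcount H : ℝ)) = mkA k F1 F2 →
        (∃ e0, IsAttachment F1 F2 Fst e0 ∧ H = {e0}) ∧ IsGeneric F1 F2 Fst)

/-- An edge `e` of `G` is closed (w.r.t. `F₁`, `F₂`): it lies in a copy of `F₁` and a copy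
of `F₂` inside `G` whose edge sets intersect exactly in `{e}`. -/
def ClosedEdge (F1 F2 G : Finset (Finset ℕ)) (e : Finset ℕ) : Prop :=
  ∃ A ⊆ G, ∃ B ⊆ G, IsCopy F1 A ∧ IsCopy F2 B ∧ A ∩ B = {e}

/-- Every edge of `G` is closed within `G`. -/
def SelfClosed (F1 F2 G : Finset (Finset ℕ)) : Prop := ∀ e ∈ G, ClosedEdge F1 F2 G e

/-- `Ĥ`: the subgraph of `H` obtained by repeatedly deleting open edges; equivalently the
largest subgraph of `H` all of whose edges are closed within it. -/
noncomputable def hatH (F1 F2 H : Finset (Finset ℕ)) : Finset (Finset ℕ) :=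
  (H.powerset.filter (fun G => SelfClosed F1 F2 G)).sup id

/-- `G'` is an `(F₁,F₂)`-core of `Ĥ`. -/
def IsCore (F1 F2 H G' : Finset (Finset ℕ)) : Prop :=
  G' ⊆ hatH F1 F2 H ∧
    ∀ A ⊆ hatH F1 F2 H, (IsCopy F1 A ∨ IsCopy F2 A) → (A ⊆ G' ∨ A ∩ G' = ∅)

/-- `G'` is a minimal (nonempty) closed `(F₁,F₂)`-core of `Ĥ`. -/
def IsMinimalCore (F1 F2 H G' : Finset (Finset ℕ)) : Prop :=
  G'.Nonempty ∧ IsCore F1 F2 H G' ∧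
    ∀ G'' ⊆ G', G''.Nonempty → G'' ≠ G' → ¬ IsCore F1 F2 H G''


theorem mem_vset {G : Finset (Finset ℕ)} {x : ℕ} : x ∈ vset G ↔ ∃ e ∈ G, x ∈ e := by
  simp [vset, Finset.mem_sup]

theorem vset_mono {G H : Finset (Finset ℕ)} (h : G ⊆ H) : vset G ⊆ vset H := by
  intro x hx
  rw [mem_vset] at *
  obtain ⟨e, he, hx⟩ := hx
  exact ⟨e, h he, hx⟩

theorem vset_union (G H : Finset (Finset ℕ)) : vset (G ∪ H) = vset G ∪ vset H := by
  ext x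
  simp only [Finset.mem_union, mem_vset]
  grind

theorem vset_singleton (e : Finset ℕ) : vset {e} = e := by simp [vset]

theorem sub_vset {G : Finset (Finset ℕ)} {e : Finset ℕ} (h : e ∈ G) : e ⊆ vset G := by
  intro x hx
  exact mem_vset.2 ⟨e, h, hx⟩

theorem card_vset_le {k : ℕ} {G : Finset (Finset ℕ)} (h : IsUniform k G) :
    (vset G).card ≤ k * G.card := by
  have : vset G = G.biUnion id := by
    ext x; simp [mem_vset]
  rw [this, mul_comm]
  exact Finset.card_biUnion_le_card_mul _ _ _ (fun e he => (h e he).le)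

theorem copy_card_le {F F' : Finset (Finset ℕ)} (h : IsCopy F F') : F'.card ≤ F.card := by
  obtain ⟨f, _, rfl⟩ := h
  exact Finset.card_image_le

theorem copy_uniform {k : ℕ} {F F' : Finset (Finset ℕ)} (h : IsCopy F F') (hu : IsUniform k F) :
    IsUniform k F' := by
  obtain ⟨f, hf, rfl⟩ := h
  intro e he
  rw [Finset.mem_image] at he
  obtain ⟨e, he, rfl⟩ := he
  rw [Finset.card_image_of_injOn, hu e he]
  exact hf.mono (by exact_mod_cast sub_vset he)

theorem copy_nonempty {F F' : Finset (Finset ℕ)} (h : IsCopy F F') (hF : F.Nonempty) :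
    F'.Nonempty := by
  obtain ⟨f, hf, rfl⟩ := h
  exact hF.image _

theorem copy_card {F F' : Finset (Finset ℕ)} (h : IsCopy F F') : F'.card = F.card := by
  obtain ⟨f, hf, rfl⟩ := h
  apply Finset.card_image_of_injOn
  intro e he e' he' hee
  have h1 : (e : Set ℕ) ⊆ vset F := by exact_mod_cast sub_vset he
  have h2 : (e' : Set ℕ) ⊆ vset F := by exact_mod_cast sub_vset he'
  have h3 : f '' (e : Set ℕ) = f '' (e' : Set ℕ) := by
    have := congrArg (fun s : Finset ℕ => (s : Set ℕ)) hee
    simpa using this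
  exact_mod_cast (hf.image_eq_image_iff h1 h2).1 h3

/-- uniform bound on the number of vertices of members of the family. -/
theorem attach_bound {k : ℕ} {F1 F2 Fst : Finset (Finset ℕ)} {e0 : Finset ℕ}
    (hu1 : IsUniform k F1) (hu2 : IsUniform k F2) (h : IsAttachment F1 F2 Fst e0) :
    (vset Fst).card ≤ k * (F2.card + F2.card * F1.card) := by
  obtain ⟨F2', he, hc, g, hg, rfl⟩ := h
  have hU : IsUniform k (F2' ∪ (F2'.erase e0).biUnion g) := by
    intro e he
    rw [Finset.mem_union, Finset.mem_biUnion] at he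
    rcases he with he | ⟨e', he', he⟩
    · exact copy_uniform hc hu2 e he
    · exact copy_uniform (hg e' he').1 hu1 e he
  refine (card_vset_le hU).trans ?_
  apply Nat.mul_le_mul_left
  refine (Finset.card_union_le _ _).trans ?_
  apply Nat.add_le_add (copy_card_le hc)
  refine (Finset.card_biUnion_le_card_mul _ _ F1.card
    (fun e he => copy_card_le (hg e he).1)).trans ?_
  apply Nat.mul_le_mul_right
  exact (Finset.card_le_card (Finset.erase_subset _ _)).trans (copy_card_le hc)

theorem attach_mem {F1 F2 Fst : Finset (Finset ℕ)} {e0 : Finset ℕ}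
    (h : IsAttachment F1 F2 Fst e0) : e0 ∈ Fst := by
  obtain ⟨F2', he, hc, g, hg, rfl⟩ := h
  exact Finset.mem_union_left _ he

theorem arrow2_mono {G H F1 F2 : Finset (Finset ℕ)} (h : G ⊆ H) (hG : Arrow2 G F1 F2) :
    Arrow2 H F1 F2 := by
  intro χ
  rcases hG χ with ⟨F', h1, h2⟩ | ⟨F', h1, h2⟩
  · exact Or.inl ⟨F', h1.trans h, h2⟩
  · exact Or.inr ⟨F', h1.trans h, h2⟩

/-- a minimal Ramsey subgraph: every edge is closed. -/
theorem min_closed {C F1 F2 : Finset (Finset ℕ)} (hC : Arrow2 C F1 F2)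
    (hmin : ∀ H ⊂ C, ¬ Arrow2 H F1 F2) (e : Finset ℕ) (he : e ∈ C) :
    ∃ A ⊆ C, ∃ B ⊆ C, IsCopy F1 A ∧ IsCopy F2 B ∧ e ∈ A ∧ e ∈ B := by
  have h := hmin _ (Finset.erase_ssubset he)
  unfold Arrow2 at h
  push Not at h
  obtain ⟨χ, h0, h1⟩ := h
  have key : ∀ j i : Fin 2, ∀ F' ⊆ C, (∀ x ∈ F', Function.update χ e j x = i) → e ∉ F' →
      F' ⊆ C.erase e ∧ ∀ x ∈ F', χ x = i := by
    intro j i F' hF' hx hn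
    refine ⟨fun x hxF => Finset.mem_erase.2 ⟨fun hh => hn (hh ▸ hxF), hF' hxF⟩, fun x hxF => ?_⟩
    have := hx x hxF
    have hne : x ≠ e := fun hh => hn (hh ▸ hxF)
    rwa [Function.update_of_ne hne] at this
  have hA : ∃ A ⊆ C, IsCopy F1 A ∧ e ∈ A := by
    rcases hC (Function.update χ e 0) with ⟨A, hA, hcA, hx⟩ | ⟨B, hB, hcB, hx⟩
    · by_cases hn : e ∈ A
      · exact ⟨A, hA, hcA, hn⟩
      · obtain ⟨h2, h3⟩ := key 0 0 A hA hx hn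
        obtain ⟨x, hx, hx'⟩ := h0 A h2 hcA
        exact absurd (h3 x hx) hx'
    · have hn : e ∉ B := by
        intro hn
        have := hx e hn
        simp at this
      obtain ⟨h2, h3⟩ := key 0 1 B hB hx hn
      obtain ⟨x, hx, hx'⟩ := h1 B h2 hcB
      exact absurd (h3 x hx) hx'
  have hB : ∃ A ⊆ C, IsCopy F2 A ∧ e ∈ A := by
    rcases hC (Function.update χ e 1) with ⟨B, hB, hcB, hx⟩ | ⟨A, hA, hcA, hx⟩
    · have hn : e ∉ B := by
        intro hn
        have := hx e hn
        simp at this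
      obtain ⟨h2, h3⟩ := key 1 0 B hB hx hn
      obtain ⟨x, hx, hx'⟩ := h0 B h2 hcB
      exact absurd (h3 x hx) hx'
    · by_cases hn : e ∈ A
      · exact ⟨A, hA, hcA, hn⟩
      · obtain ⟨h2, h3⟩ := key 1 1 A hA hx hn
        obtain ⟨x, hx, hx'⟩ := h1 A h2 hcA
        exact absurd (h3 x hx) hx'
  obtain ⟨A, h1, h2, h3⟩ := hA
  obtain ⟨B, h4, h5, h6⟩ := hB
  exact ⟨A, h1, B, h4, h2, h5, h3, h6⟩

/-- a minimal Ramsey subgraph is connected via copies. -/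
theorem min_conn {C F1 F2 G : Finset (Finset ℕ)} (hC : Arrow2 C F1 F2)
    (hmin : ∀ H ⊂ C, ¬ Arrow2 H F1 F2) (hG : G ⊆ C) (hne : G.Nonempty)
    (hcl : ∀ A ⊆ C, (IsCopy F1 A ∨ IsCopy F2 A) → (∃ e ∈ A, e ∈ G) → A ⊆ G) : G = C := by
  by_contra hGC
  have hG1 : G ⊂ C := Finset.ssubset_iff_subset_ne.2 ⟨hG, hGC⟩
  have hG2 : C \ G ⊂ C := Finset.sdiff_ssubset hG hne
  have h1 := hmin _ hG1
  have h2 := hmin _ hG2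
  unfold Arrow2 at h1 h2
  push Not at h1 h2
  obtain ⟨χ, h10, h11⟩ := h1
  obtain ⟨ψ, h20, h21⟩ := h2
  have key : ∀ i : Fin 2, ∀ A ⊆ C, (IsCopy F1 A ∨ IsCopy F2 A) →
      (∀ x ∈ A, (if x ∈ G then χ x else ψ x) = i) →
      (A ⊆ G ∧ ∀ x ∈ A, χ x = i) ∨ (A ⊆ C \ G ∧ ∀ x ∈ A, ψ x = i) := by
    intro i A hA hc hx
    by_cases hh : ∃ e ∈ A, e ∈ G
    · have hs := hcl A hA hc hh
      left
      refine ⟨hs, fun x hxA => ?_⟩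
      have := hx x hxA
      rwa [if_pos (hs hxA)] at this
    · push Not at hh
      right
      refine ⟨fun x hxA => Finset.mem_sdiff.2 ⟨hA hxA, hh x hxA⟩, fun x hxA => ?_⟩
      have := hx x hxA
      rwa [if_neg (hh x hxA)] at this
  rcases hC (fun x => if x ∈ G then χ x else ψ x) with ⟨A, hA, hcA, hx⟩ | ⟨A, hA, hcA, hx⟩
  · rcases key 0 A hA (Or.inl hcA) hx with ⟨h3, h4⟩ | ⟨h3, h4⟩
    · obtain ⟨x, hx, hx'⟩ := h10 A h3 hcA
      exact hx' (h4 x hx)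
    · obtain ⟨x, hx, hx'⟩ := h20 A h3 hcA
      exact hx' (h4 x hx)
  · rcases key 1 A hA (Or.inr hcA) hx with ⟨h3, h4⟩ | ⟨h3, h4⟩
    · obtain ⟨x, hx, hx'⟩ := h11 A h3 hcA
      exact hx' (h4 x hx)
    · obtain ⟨x, hx, hx'⟩ := h21 A h3 hcA
      exact hx' (h4 x hx)

/-- a set of edges closed under attaching is everything. -/
theorem min_grow {C F1 F2 G : Finset (Finset ℕ)} (hC : Arrow2 C F1 F2) (h2 : 2 ≤ F2.card)
    (hmin : ∀ H ⊂ C, ¬ Arrow2 H F1 F2) (hG : G ⊆ C) (hne : G.Nonempty)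
    (hcl : ∀ e ∈ G, ∀ Fst ⊆ C, IsAttachment F1 F2 Fst e → Fst ⊆ G) : G = C := by
  have hclosed := min_closed hC hmin
  choose! A hA B hB hcA hcB heA heB using hclosed
  have h2step : ∀ D ⊆ C, IsCopy F2 D → (∃ e ∈ D, e ∈ G) → D ⊆ G := by
    rintro D hD hc ⟨e, heD, heG⟩
    refine Finset.Subset.trans Finset.subset_union_left (hcl e heG
      (D ∪ (D.erase e).biUnion A) ?_ ⟨D, heD, hc, A, ?_, rfl⟩)
    · apply Finset.union_subset hD
      apply Finset.biUnion_subset.2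
      intro x hx
      exact hA x (hD (Finset.mem_of_mem_erase hx))
    · intro x hx
      have := hD (Finset.mem_of_mem_erase hx)
      exact ⟨hcA x this, heA x this⟩
  apply min_conn hC hmin hG hne
  rintro D hD (hc | hc) ⟨e, heD, heG⟩
  · have heC := hG heG
    have hBG := h2step (B e) (hB e heC) (hcB e heC) ⟨e, heB e heC, heG⟩
    obtain ⟨b, hb, hbe⟩ : ∃ b ∈ B e, b ≠ e := by
      apply Finset.exists_mem_ne
      rw [copy_card (hcB e heC)]
      omega
    have hmem : e ∈ (B e).erase b := Finset.mem_erase.2 ⟨hbe.symm, heB e heC⟩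
    have := hcl b (hBG hb) (B e ∪ ((B e).erase b).biUnion (Function.update A e D)) ?_
      ⟨B e, hb, hcB e heC, Function.update A e D, ?_, rfl⟩
    · refine Finset.Subset.trans ?_ this
      refine Finset.Subset.trans ?_ Finset.subset_union_right
      refine Finset.Subset.trans ?_ (Finset.subset_biUnion_of_mem _ hmem)
      simp
    · apply Finset.union_subset (hB e heC)
      apply Finset.biUnion_subset.2
      intro x hx
      have hxC := hB e heC (Finset.mem_of_mem_erase hx)
      by_cases hxe : x = e
      · subst hxe; simpa using hD
      · rw [Function.update_of_ne hxe]; exact hA x hxC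
    · intro x hx
      have hxC := hB e heC (Finset.mem_of_mem_erase hx)
      by_cases hxe : x = e
      · subst hxe; simpa using ⟨hc, heD⟩
      · rw [Function.update_of_ne hxe]; exact ⟨hcA x hxC, heA x hxC⟩
  · exact h2step D hD hc ⟨e, heD, heG⟩

/-- the effect of one attaching step. -/
theorem step_lemma {k a b : ℕ} {F1 F2 G Fst : Finset (Finset ℕ)} {e : Finset ℕ}
    (ha : 0 < a) (hb : 0 < b)
    (hm : mkA k F1 F2 = (a : ℝ) / b) (hab : AsymBalanced k F1 F2)
    (hat : IsAttachment F1 F2 Fst e) (heG : e ∈ G) (hns : ¬ Fst ⊆ G) :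
    a * (vset Fst \ vset G).card ≤ b * (Fst \ G).card ∧
    (vset Fst ∩ vset G = e ∨ a * (vset Fst \ vset G).card + 1 ≤ b * (Fst \ G).card) := by
  have heF := attach_mem hat
  have hHG : Fst ∩ G ⊆ G := Finset.inter_subset_right
  have hHF : Fst ∩ G ⊆ Fst := Finset.inter_subset_left
  have hpos : 0 < (Fst \ G).card := by
    rw [Finset.card_pos, Finset.sdiff_nonempty]; exact hns
  have hVH : vset (Fst ∩ G) ⊆ vset Fst ∩ vset G :=
    Finset.subset_inter (vset_mono hHF) (vset_mono hHG)
  have hc1 : (vset Fst \ vset G).card + (vset Fst ∩ vset G).card = (vset Fst).card :=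
    Finset.card_sdiff_add_card_inter _ _
  have hc2 : (Fst \ G).card + (Fst ∩ G).card = Fst.card :=
    Finset.card_sdiff_add_card_inter _ _
  have hc3 := Finset.card_le_card hVH
  by_cases hV : vset (Fst ∩ G) = vset Fst
  · have h0 : (vset Fst \ vset G).card = 0 := by
      rw [hV] at hc3; omega
    rw [h0]
    have : 0 < b * (Fst \ G).card := Nat.mul_pos hb hpos
    exact ⟨by omega, Or.inr (by omega)⟩
  · have hss : vset (Fst ∩ G) ⊂ vset Fst :=
      Finset.ssubset_iff_subset_ne.2 ⟨vset_mono hHF, hV⟩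
    have hlt := Finset.card_lt_card hss
    obtain ⟨q1, q2⟩ := hab Fst ⟨e, hat⟩ (Fst ∩ G) hHF hss
      ⟨e, Finset.mem_inter.2 ⟨heF, heG⟩, hat⟩
    obtain ⟨t, ht⟩ : ∃ t, (vset Fst).card = (vset (Fst ∩ G)).card + t := ⟨_, (Nat.add_sub_of_le hlt.le).symm⟩
    have ht0 : 0 < t := by omega
    have hr : ((Fst.card : ℝ) - ((Fst ∩ G).card : ℝ)) / ((vcount Fst : ℝ) - (vcount (Fst ∩ G) : ℝ))
        = ((Fst \ G).card : ℝ) / t := by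
      unfold vcount
      rw [ht, ← hc2]
      push_cast
      ring
    rw [hr, hm] at q1 q2
    have hb' : (0 : ℝ) < b := by exact_mod_cast hb
    have ht' : (0 : ℝ) < t := by exact_mod_cast ht0
    have q1' : a * t ≤ b * (Fst \ G).card := by
      rw [div_le_div_iff₀ hb' ht'] at q1
      have : a * t ≤ (Fst \ G).card * b := by exact_mod_cast q1
      linarith
    have hle : (vset Fst \ vset G).card ≤ t := by omega
    have hle' := Nat.mul_le_mul_left a hle
    refine ⟨hle'.trans q1', ?_⟩
    by_contra hcon
    push Not at hcon
    obtain ⟨c1, c2⟩ := hcon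
    have e1 : a * t = b * (Fst \ G).card := by omega
    have e2 : a * (vset Fst \ vset G).card = a * t := by omega
    have e3 : (vset Fst \ vset G).card = t := Nat.eq_of_mul_eq_mul_left ha e2
    have e4 : vset (Fst ∩ G) = vset Fst ∩ vset G :=
      Finset.eq_of_subset_of_card_le hVH (by omega)
    have e5 : ((Fst \ G).card : ℝ) / t = (a : ℝ) / b := by
      rw [div_eq_div_iff ht'.ne' hb'.ne']
      have : (Fst \ G).card * b = a * t := by linarith
      exact_mod_cast this
    obtain ⟨⟨e0, _, he0⟩, _⟩ := q2 e5
    have : e = e0 := by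
      have : e ∈ Fst ∩ G := Finset.mem_inter.2 ⟨heF, heG⟩
      rw [he0] at this
      simpa using this
    apply c1
    rw [← e4, he0, vset_singleton, this]

/-- selection of an unprocessed edge. -/
noncomputable def selE (G D : Finset (Finset ℕ)) : Finset ℕ :=
  if h : (G \ D).Nonempty then h.choose else ∅

theorem selE_mem {G D : Finset (Finset ℕ)} (h : (G \ D).Nonempty) : selE G D ∈ G \ D := by
  unfold selE
  rw [dif_pos h]
  exact h.choose_spec

/-- states reachable by the exploration process. -/
inductive Reach (F1 F2 E : Finset (Finset ℕ)) (s : ℕ) :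
    Finset (Finset ℕ) → Finset (Finset ℕ) → Prop
  | init (e : Finset ℕ) (he : e ∈ E) : Reach F1 F2 E s {e} ∅
  | adv (G D : Finset (Finset ℕ)) (h : Reach F1 F2 E s G D) (hs : G.card ≤ s)
      (hne : (G \ D).Nonempty) : Reach F1 F2 E s G (insert (selE G D) D)
  | att (G D X : Finset (Finset ℕ)) (h : Reach F1 F2 E s G D) (hs : G.card ≤ s)
      (hne : (G \ D).Nonempty) (hX : X ⊆ E) (ha : IsAttachment F1 F2 X (selE G D))
      (hn : ¬ X ⊆ G) : Reach F1 F2 E s (G ∪ X) D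

theorem reach_sub {F1 F2 E : Finset (Finset ℕ)} {s : ℕ} {G D : Finset (Finset ℕ)}
    (h : Reach F1 F2 E s G D) : G ⊆ E ∧ D ⊆ G := by
  induction h with
  | init e he => exact ⟨by simpa using he, by simp⟩
  | adv G D h hs hne ih =>
    refine ⟨ih.1, Finset.insert_subset ?_ ih.2⟩
    exact (Finset.mem_sdiff.1 (selE_mem hne)).1
  | att G D X h hs hne hX ha hn ih =>
    exact ⟨Finset.union_subset ih.1 hX, ih.2.trans Finset.subset_union_left⟩

theorem card_union' (G X : Finset (Finset ℕ)) : (G ∪ X).card = G.card + (X \ G).card := by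
  rw [← Finset.union_sdiff_self_eq_union, Finset.card_union_of_disjoint Finset.disjoint_sdiff]

theorem card_vset_union (G X : Finset (Finset ℕ)) :
    (vset (G ∪ X)).card = (vset G).card + (vset X \ vset G).card := by
  rw [vset_union, ← Finset.union_sdiff_self_eq_union,
    Finset.card_union_of_disjoint Finset.disjoint_sdiff]

theorem reach_dens {k a b : ℕ} {F1 F2 E : Finset (Finset ℕ)} {s : ℕ} {G D : Finset (Finset ℕ)}
    (ha : 0 < a) (hb : 0 < b) (hE : IsUniform k E)
    (hm : mkA k F1 F2 = (a : ℝ) / b) (hab : AsymBalanced k F1 F2)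
    (h : Reach F1 F2 E s G D) : a * (vset G).card ≤ b * G.card + a * k := by
  induction h with
  | init e he => rw [vset_singleton, hE e he]; omega
  | adv G D h hs hne ih => exact ih
  | att G D X h hs hne hX hat hn ih =>
    have := (step_lemma ha hb hm hab hat (Finset.mem_sdiff.1 (selE_mem hne)).1 hn).1
    rw [card_union', card_vset_union, Nat.mul_add, Nat.mul_add]
    omega

/-- the exploration either gets large or exhausts the minimal Ramsey graph. -/
theorem reach_exhaust {F1 F2 E C : Finset (Finset ℕ)} {s : ℕ} (hC : Arrow2 C F1 F2)
    (h2 : 2 ≤ F2.card)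
    (hmin : ∀ H ⊂ C, ¬ Arrow2 H F1 F2) (hCE : C ⊆ E) (hne : C.Nonempty) :
    ∃ G D, Reach F1 F2 E s G D ∧ G ⊆ C ∧ (s < G.card ∨ G = C) := by
  by_contra hcon
  push Not at hcon
  have key : ∀ t : ℕ, ∃ G D, Reach F1 F2 E s G D ∧ G ⊆ C ∧ G.Nonempty ∧
      (∀ e ∈ D, ∀ X ⊆ C, IsAttachment F1 F2 X e → X ⊆ G) ∧ t ≤ G.card + D.card := by
    intro t
    induction t with
    | zero =>
      obtain ⟨e, he⟩ := hne
      exact ⟨{e}, ∅, Reach.init e (hCE he), by simpa using he, by simp, by simp, by simp⟩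
    | succ t ih =>
      obtain ⟨G, D, hR, hGC, hGne, hcl, ht⟩ := ih
      obtain ⟨hs, hGC'⟩ := hcon G D hR hGC
      have hDG := (reach_sub hR).2
      have hnE : (G \ D).Nonempty := by
        rw [Finset.sdiff_nonempty]
        intro hGD
        have : D = G := Finset.Subset.antisymm hDG hGD
        subst this
        exact hGC' (min_grow hC h2 hmin hGC hGne hcl)
      have hsel := Finset.mem_sdiff.1 (selE_mem hnE)
      by_cases hX : ∃ X ⊆ C, IsAttachment F1 F2 X (selE G D) ∧ ¬ X ⊆ G
      · obtain ⟨X, hXC, hat, hn⟩ := hX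
        refine ⟨G ∪ X, D, Reach.att G D X hR hs hnE (hXC.trans hCE) hat hn,
          Finset.union_subset hGC hXC, hGne.mono Finset.subset_union_left,
          fun e he Y hY hYa => (hcl e he Y hY hYa).trans Finset.subset_union_left, ?_⟩
        rw [card_union']
        have : 0 < (X \ G).card := by
          rw [Finset.card_pos, Finset.sdiff_nonempty]; exact hn
        omega
      · push Not at hX
        refine ⟨G, insert (selE G D) D, Reach.adv G D hR hs hnE, hGC, hGne, ?_, ?_⟩
        · intro e he Y hY hYa
          rcases Finset.mem_insert.1 he with rfl | he
          · exact hX Y hY hYa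
          · exact hcl e he Y hY hYa
        · rw [Finset.card_insert_of_notMem hsel.2]
          omega
  obtain ⟨G, D, hR, hGC, -, -, ht⟩ := key (2 * C.card + 1)
  have h1 := Finset.card_le_card hGC
  have h2 := Finset.card_le_card (reach_sub hR).2
  omega

/-- in a minimal Ramsey graph, negativity of the potential is inherited upwards. -/
theorem min_dens {k a b : ℕ} {F1 F2 C H : Finset (Finset ℕ)}
    (ha : 0 < a) (hb : 0 < b) (hC : Arrow2 C F1 F2) (h2 : 2 ≤ F2.card)
    (hmin : ∀ H ⊂ C, ¬ Arrow2 H F1 F2)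
    (hm : mkA k F1 F2 = (a : ℝ) / b) (hab : AsymBalanced k F1 F2)
    (hHC : H ⊆ C) (hHn : H.Nonempty) (hH : a * (vset H).card < b * H.card) :
    a * (vset C).card < b * C.card := by
  by_contra hcon
  have key : ∀ t : ℕ, ∃ G ⊆ C, G.Nonempty ∧ a * (vset G).card < b * G.card ∧ t ≤ G.card := by
    intro t
    induction t with
    | zero => exact ⟨H, hHC, hHn, hH, by simp⟩
    | succ t ih =>
      obtain ⟨G, hGC, hGn, hG, ht⟩ := ih
      have hne : G ≠ C := by rintro rfl; exact hcon hG
      have : ∃ e ∈ G, ∃ X ⊆ C, IsAttachment F1 F2 X e ∧ ¬ X ⊆ G := by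
        by_contra hh
        push Not at hh
        exact hne (min_grow hC h2 hmin hGC hGn hh)
      obtain ⟨e, he, X, hXC, hat, hn⟩ := this
      have hst := (step_lemma ha hb hm hab hat he hn).1
      have : 0 < (X \ G).card := by
        rw [Finset.card_pos, Finset.sdiff_nonempty]; exact hn
      refine ⟨G ∪ X, Finset.union_subset hGC hXC, hGn.mono Finset.subset_union_left, ?_, ?_⟩
      · rw [card_union', card_vset_union, Nat.mul_add, Nat.mul_add]
        omega
      · rw [card_union']; omega
  obtain ⟨G, hGC, -, -, ht⟩ := key (C.card + 1)
  have h1 := Finset.card_le_card hGC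
  omega

/-- Ramsey graphs contain a bad reachable state. -/
theorem arrow_bad {k n a b s : ℕ} {F1 F2 G : Finset (Finset ℕ)}
    (ha : 0 < a) (hb : 0 < b) (h2 : 2 ≤ F2.card)
    (hm : mkA k F1 F2 = (a : ℝ) / b) (hab : AsymBalanced k F1 F2)
    (hiv : ∀ G : Finset (Finset ℕ), IsUniform k G →
      mDens G ≤ mkA k F1 F2 → ¬ Arrow2 G F1 F2)
    (hG : G ⊆ allEdges k n) (hA : Arrow2 G F1 F2) :
    ∃ S D, Reach F1 F2 (allEdges k n) s S D ∧ S ⊆ G ∧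
      (s < S.card ∨ a * (vset S).card < b * S.card) := by
  obtain ⟨C, hCG, hC⟩ := exists_minimal_le_of_wellFoundedLT (fun H => Arrow2 H F1 F2) G hA
  have hCG' : C ⊆ G := hCG
  have hmin : ∀ H ⊂ C, ¬ Arrow2 H F1 F2 := fun H hH hAH => hC.not_lt hAH hH
  have hAC : Arrow2 C F1 F2 := hC.prop
  have huC : IsUniform k C := fun e he =>
    (Finset.mem_powersetCard.1 (hG (hCG' he))).2
  have hm0 : (0 : ℝ) ≤ (a : ℝ) / b := by positivity
  have hd : ∃ H ⊆ C, H.Nonempty ∧ a * (vset H).card < b * H.card := by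
    by_contra hcon
    push Not at hcon
    refine hiv C huC ?_ hAC
    rw [hm]
    apply Real.sSup_le _ hm0
    rintro x ⟨H, hH, hv, rfl⟩
    have hHn : H.Nonempty := by
      rw [Finset.nonempty_iff_ne_empty]
      rintro rfl
      simp [vcount, vset] at hv
    have h1 := hcon H hH hHn
    have hv' : (0 : ℝ) < (vcount H : ℝ) := by exact_mod_cast hv
    have hb' : (0 : ℝ) < (b : ℝ) := by exact_mod_cast hb
    rw [div_le_div_iff₀ hv' hb']
    have : H.card * b ≤ a * vcount H := by
      unfold vcount; linarith
    exact_mod_cast this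
  obtain ⟨H, hHC, hHn, hH⟩ := hd
  have hdC := min_dens ha hb hAC h2 hmin hm hab hHC hHn hH
  obtain ⟨S, D, hR, hSC, hS⟩ :=
    reach_exhaust (s := s) hAC h2 hmin (hCG'.trans hG) (hHn.mono hHC)
  refine ⟨S, D, hR, hSC.trans hCG', ?_⟩
  rcases hS with hS | rfl
  · exact Or.inl hS
  · exact Or.inr hdC

theorem dk_rat (k : ℕ) (G : Finset (Finset ℕ)) : ∃ q : ℚ, dk k G = q := by
  unfold dk
  split_ifs
  · exact ⟨0, by simp⟩
  · exact ⟨1 / k, by push_cast; rfl⟩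
  · exact ⟨((G.card : ℚ) - 1) / ((vcount G : ℚ) - k), by push_cast; rfl⟩

theorem mk_rat (k : ℕ) (G : Finset (Finset ℕ)) : ∃ q : ℚ, mk k G = q := by
  have hfin : {x : ℝ | ∃ H ⊆ G, x = dk k H}.Finite := by
    apply ((G.powerset.image (dk k)).finite_toSet).subset
    rintro x ⟨H, hH, rfl⟩
    simp only [Finset.coe_image, Set.mem_image, Finset.mem_coe, Finset.mem_powerset]
    exact ⟨H, hH, rfl⟩
  have hne : {x : ℝ | ∃ H ⊆ G, x = dk k H}.Nonempty := ⟨_, G, subset_rfl, rfl⟩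
  obtain ⟨H, -, hx⟩ := hne.csSup_mem hfin
  obtain ⟨q, hq⟩ := dk_rat k H
  exact ⟨q, by unfold mk; rw [hx, hq]⟩

theorem mk_pos_nonempty {k : ℕ} {G : Finset (Finset ℕ)} (h : 0 < mk k G) : G.Nonempty := by
  rw [Finset.nonempty_iff_ne_empty]
  rintro rfl
  have : {x : ℝ | ∃ H ⊆ (∅ : Finset (Finset ℕ)), x = dk k H} = {0} := by
    ext x
    simp [dk]
  unfold mk at h
  rw [this] at h
  simp at h

theorem mkA_rat {k : ℕ} {F1 F2 : Finset (Finset ℕ)} (hu : IsUniform k F1) (h1 : F1.Nonempty)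
    (h2 : 0 < mk k F2) : ∃ a b : ℕ, 0 < a ∧ 0 < b ∧ mkA k F1 F2 = (a : ℝ) / b := by
  have hfin : {x : ℝ | ∃ H ⊆ F1, H.Nonempty ∧
    x = (H.card : ℝ) / ((vcount H : ℝ) - (k : ℝ) + 1 / mk k F2)}.Finite := by
    apply ((F1.powerset.image (fun H =>
      (H.card : ℝ) / ((vcount H : ℝ) - (k : ℝ) + 1 / mk k F2))).finite_toSet).subset
    rintro x ⟨H, hH, -, rfl⟩
    simp only [Finset.coe_image, Set.mem_image, Finset.mem_coe, Finset.mem_powerset]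
    exact ⟨H, hH, rfl⟩
  have hne : {x : ℝ | ∃ H ⊆ F1, H.Nonempty ∧
    x = (H.card : ℝ) / ((vcount H : ℝ) - (k : ℝ) + 1 / mk k F2)}.Nonempty :=
    ⟨_, F1, subset_rfl, h1, rfl⟩
  obtain ⟨H, hHF, hHn, hx⟩ := hne.csSup_mem hfin
  obtain ⟨q, hq⟩ := mk_rat k F2
  have hvk : k ≤ vcount H := by
    obtain ⟨e, he⟩ := hHn
    rw [← hu e (hHF he)]
    exact Finset.card_le_card (sub_vset he)
  have hvk' : (k : ℝ) ≤ vcount H := by exact_mod_cast hvk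
  have hc : (0 : ℝ) < H.card := by exact_mod_cast hHn.card_pos
  have hpos : 0 < mkA k F1 F2 := by
    unfold mkA
    rw [hx]
    have : 0 < 1 / mk k F2 := by positivity
    apply div_pos hc
    linarith
  set Q : ℚ := (H.card : ℚ) / ((vcount H : ℚ) - (k : ℚ) + 1 / q) with hQ
  have hmQ : mkA k F1 F2 = Q := by
    unfold mkA
    rw [hx, hq, hQ]
    push_cast
    rfl
  have hQ0 : 0 < Q := by rw [hmQ] at hpos; exact_mod_cast hpos
  have hn : 0 < Q.num := Rat.num_pos.2 hQ0
  refine ⟨Q.num.toNat, Q.den, by omega, Q.den_pos, ?_⟩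
  rw [hmQ]
  have h5 : ((Q.num.toNat : ℕ) : ℝ) = ((Q.num : ℤ) : ℝ) := by
    have : ((Q.num.toNat : ℕ) : ℤ) = Q.num := Int.toNat_of_nonneg hn.le
    exact_mod_cast congrArg (fun z : ℤ => (z : ℝ)) this
  rw [h5, Rat.cast_def]

/-- union bound. -/
theorem sum_contain {E S : Finset (Finset ℕ)} (hS : S ⊆ E) (p : ℝ) :
    ∑ G ∈ E.powerset with S ⊆ G, p ^ G.card * (1 - p) ^ (E.card - G.card) = p ^ S.card := by
  have h1 : ∑ T ∈ (E \ S).powerset, p ^ T.card * (1 - p) ^ ((E \ S).card - T.card) = 1 := by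
    rw [Finset.sum_pow_mul_eq_add_pow]
    simp
  calc ∑ G ∈ E.powerset with S ⊆ G, p ^ G.card * (1 - p) ^ (E.card - G.card)
      = ∑ T ∈ (E \ S).powerset, p ^ S.card * (p ^ T.card * (1 - p) ^ ((E \ S).card - T.card)) := by
        symm
        apply Finset.sum_bij' (fun T _ => S ∪ T) (fun G _ => G \ S)
        · intro T hT
          rw [Finset.mem_powerset] at hT
          simp only [Finset.mem_filter, Finset.mem_powerset]
          exact ⟨Finset.union_subset hS (hT.trans Finset.sdiff_subset), Finset.subset_union_left⟩
        · intro G hG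
          simp only [Finset.mem_filter, Finset.mem_powerset] at hG ⊢
          exact Finset.sdiff_subset_sdiff hG.1 subset_rfl
        · intro T hT
          rw [Finset.mem_powerset] at hT
          rw [Finset.union_sdiff_left]
          apply Finset.sdiff_eq_self_of_disjoint
          exact Finset.disjoint_of_subset_left hT Finset.sdiff_disjoint
        · intro G hG
          simp only [Finset.mem_filter, Finset.mem_powerset] at hG
          exact Finset.union_sdiff_of_subset hG.2
        · intro T hT
          rw [Finset.mem_powerset] at hT
          have hd : Disjoint S T :=
            (Finset.disjoint_of_subset_left hT Finset.sdiff_disjoint).symm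
          rw [Finset.card_union_of_disjoint hd, Finset.card_sdiff_of_subset hS, pow_add, mul_assoc,
            Nat.sub_sub]
    _ = p ^ S.card := by rw [← Finset.mul_sum, h1, mul_one]

theorem prob_nonneg {k n : ℕ} {p : ℝ} (hp : 0 ≤ p) (hp1 : p ≤ 1)
    (P : Finset (Finset ℕ) → Prop) : 0 ≤ prob k n p P := by
  apply Finset.sum_nonneg
  intro G hG
  split_ifs
  · have : 0 ≤ 1 - p := by linarith
    positivity
  · exact le_rfl

theorem prob_le_sum {ι : Type*} {k n : ℕ} {p : ℝ} (hp : 0 ≤ p) (hp1 : p ≤ 1)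
    (P : Finset (Finset ℕ) → Prop) (I : Finset ι) (f : ι → Finset (Finset ℕ))
    (hf : ∀ i ∈ I, f i ⊆ allEdges k n)
    (h : ∀ G ⊆ allEdges k n, P G → ∃ i ∈ I, f i ⊆ G) :
    prob k n p P ≤ ∑ i ∈ I, p ^ (f i).card := by
  have hq : 0 ≤ 1 - p := by linarith
  calc prob k n p P ≤ ∑ G ∈ (allEdges k n).powerset, ∑ i ∈ I,
        if f i ⊆ G then p ^ G.card * (1 - p) ^ ((allEdges k n).card - G.card) else 0 := by
        apply Finset.sum_le_sum
        intro G hG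
        rw [Finset.mem_powerset] at hG
        have hnn : ∀ i ∈ I, 0 ≤ (if f i ⊆ G then
            p ^ G.card * (1 - p) ^ ((allEdges k n).card - G.card) else 0) := by
          intro i _
          split_ifs <;> positivity
        split_ifs with hP
        · obtain ⟨i, hi, hiG⟩ := h G hG hP
          refine le_trans ?_ (Finset.single_le_sum hnn hi)
          rw [if_pos hiG]
        · exact Finset.sum_nonneg hnn
    _ = ∑ i ∈ I, p ^ (f i).card := by
        rw [Finset.sum_comm]
        apply Finset.sum_congr rfl
        intro i hi
        rw [← Finset.sum_filter, sum_contain (hf i hi)]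

/-- counting subsets of bounded size. -/
theorem card_small_subsets (S : Finset ℕ) (M : ℕ) :
    (S.powerset.filter (fun Y => Y.card ≤ M)).card ≤ (M + 1) * (S.card + 1) ^ M := by
  have : S.powerset.filter (fun Y => Y.card ≤ M) ⊆
      (Finset.range (M + 1)).biUnion (fun d => S.powersetCard d) := by
    intro Y hY
    simp only [Finset.mem_filter, Finset.mem_powerset] at hY
    simp only [Finset.mem_biUnion, Finset.mem_range, Finset.mem_powersetCard]
    exact ⟨Y.card, by omega, hY.1, rfl⟩
  refine (Finset.card_le_card this).trans ?_
  have h2 := Finset.card_biUnion_le_card_mul (Finset.range (M + 1))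
    (fun d => S.powersetCard d) ((S.card + 1) ^ M) (fun d hd => ?_)
  · simpa using h2
  · rw [Finset.card_powersetCard]
    refine (Nat.choose_le_pow _ _).trans ?_
    refine (Nat.pow_le_pow_left (Nat.le_succ _) d).trans ?_
    apply Nat.pow_le_pow_right (by omega)
    simp at hd; omega

theorem sum_inv_card_le (n : ℕ) (hn : 0 < n) :
    ∑ X ∈ (Finset.range n).powerset, ((n : ℝ)⁻¹) ^ X.card ≤ 3 := by
  have h := Finset.sum_pow_mul_eq_add_pow ((n : ℝ)⁻¹) 1 (Finset.range n)
  simp only [one_pow, mul_one, Finset.card_range] at h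
  rw [h]
  have h0 : (0 : ℝ) < n := by exact_mod_cast hn
  calc ((n : ℝ)⁻¹ + 1) ^ n ≤ (Real.exp ((n : ℝ)⁻¹)) ^ n := by
        apply pow_le_pow_left₀ (by positivity) (Real.add_one_le_exp _)
    _ = Real.exp 1 := by
        rw [← Real.exp_nat_mul, mul_inv_cancel₀ h0.ne']
    _ ≤ 3 := by linarith [Real.exp_one_lt_d9]

/-- counting lemma for attached graphs. -/
theorem count_lemma (n M : ℕ) (hn : 0 < n) (V : Finset ℕ) (T : Finset (Finset (Finset ℕ)))
    (Ys : Finset (Finset ℕ))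
    (h1 : ∀ X ∈ T, vset X ⊆ Finset.range n) (h2 : ∀ X ∈ T, (vset X).card ≤ M)
    (h3 : ∀ X ∈ T, vset X ∩ V ∈ Ys) :
    ∑ X ∈ T, ((n : ℝ)⁻¹) ^ (vset X \ V).card ≤ 3 * Ys.card * 2 ^ 2 ^ M := by
  have hmaps : ∀ X ∈ T, (vset X \ V, vset X ∩ V) ∈ (Finset.range n).powerset ×ˢ Ys := by
    intro X hX
    rw [Finset.mem_product]
    exact ⟨Finset.mem_powerset.2 (Finset.sdiff_subset.trans (h1 X hX)), h3 X hX⟩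
  rw [← Finset.sum_fiberwise_of_maps_to hmaps]
  calc _ ≤ ∑ q ∈ (Finset.range n).powerset ×ˢ Ys, ((n : ℝ)⁻¹) ^ q.1.card * 2 ^ 2 ^ M := by
        apply Finset.sum_le_sum
        rintro ⟨X, Y⟩ hq
        have hcard : ((T.filter (fun x => (vset x \ V, vset x ∩ V) = (X, Y))).card : ℝ)
            ≤ 2 ^ 2 ^ M := by
          rcases Finset.eq_empty_or_nonempty
            (T.filter (fun x => (vset x \ V, vset x ∩ V) = (X, Y))) with he | ⟨x0, hx0⟩
          · rw [he]; simp
          · have hV : ∀ x ∈ T.filter (fun x => (vset x \ V, vset x ∩ V) = (X, Y)),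
                vset x = X ∪ Y := by
              intro x hx
              rw [Finset.mem_filter, Prod.mk.injEq] at hx
              rw [← hx.2.1, ← hx.2.2, Finset.sdiff_union_inter]
            have hsub : T.filter (fun x => (vset x \ V, vset x ∩ V) = (X, Y)) ⊆
                (X ∪ Y).powerset.powerset := by
              intro x hx
              rw [Finset.mem_powerset]
              intro e he
              rw [Finset.mem_powerset, ← hV x hx]
              exact sub_vset he
            have hM : (X ∪ Y).card ≤ M := by
              rw [← hV x0 hx0]
              exact h2 x0 (Finset.mem_filter.1 hx0).1
            have h4 := Finset.card_le_card hsub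
            rw [Finset.card_powerset, Finset.card_powerset] at h4
            have h5 : 2 ^ 2 ^ (X ∪ Y).card ≤ 2 ^ 2 ^ M :=
              Nat.pow_le_pow_right (by norm_num) (Nat.pow_le_pow_right (by norm_num) hM)
            exact_mod_cast h4.trans h5
        have : ∀ x ∈ T.filter (fun x => (vset x \ V, vset x ∩ V) = (X, Y)),
            ((n : ℝ)⁻¹) ^ (vset x \ V).card = ((n : ℝ)⁻¹) ^ X.card := by
          intro x hx
          rw [Finset.mem_filter, Prod.mk.injEq] at hx
          rw [hx.2.1]
        rw [Finset.sum_congr rfl this, Finset.sum_const, nsmul_eq_mul, mul_comm]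
        apply mul_le_mul_of_nonneg_left hcard (by positivity)
    _ = (∑ X ∈ (Finset.range n).powerset, ((n : ℝ)⁻¹) ^ X.card) * Ys.card * 2 ^ 2 ^ M := by
        rw [← Finset.sum_mul, Finset.sum_product]
        simp only [Finset.sum_const, nsmul_eq_mul]
        rw [← Finset.mul_sum]
        ring
    _ ≤ _ := by
        gcongr
        exact sum_inv_card_le n hn

theorem sum_biUnion_le' {α β : Type*} [DecidableEq β] (S : Finset α) (f : α → Finset β) (u : β → ℝ)
    (hu : ∀ x, 0 ≤ u x) : ∑ x ∈ S.biUnion f, u x ≤ ∑ s ∈ S, ∑ x ∈ f s, u x := by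
  induction S using Finset.induction_on with
  | empty => simp
  | insert a S ha ih =>
    rw [Finset.biUnion_insert, Finset.sum_insert ha]
    have h := Finset.sum_union_inter (s₁ := f a) (s₂ := S.biUnion f) (f := u)
    have h2 : 0 ≤ ∑ x ∈ f a ∩ S.biUnion f, u x := Finset.sum_nonneg (fun x _ => hu x)
    linarith

theorem sum_image_le' {α β : Type*} [DecidableEq β] (S : Finset α) (f : α → β) (u : β → ℝ)
    (hu : ∀ x, 0 ≤ u x) : ∑ x ∈ S.image f, u x ≤ ∑ s ∈ S, u (f s) := by
  have h : S.image f = S.biUnion (fun s => {f s}) := by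
    ext x; simp [eq_comm]
  rw [h]
  refine (sum_biUnion_le' S _ u hu).trans ?_
  simp

/-- weight of a state. -/
noncomputable def wt (x ζ : ℝ) (N a b : ℕ) (σ : Finset (Finset ℕ) × Finset (Finset ℕ)) : ℝ :=
  x ^ σ.1.card * ζ ^ (N * a * (vset σ.1).card + b * σ.1.card) * (1 / 4) ^ σ.2.card

theorem wt_nonneg {x ζ : ℝ} (hx : 0 ≤ x) (hζ : 0 ≤ ζ) (N a b : ℕ)
    (σ : Finset (Finset ℕ) × Finset (Finset ℕ)) : 0 ≤ wt x ζ N a b σ := by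
  unfold wt; positivity

theorem vset_allEdges {k n : ℕ} {X : Finset (Finset ℕ)} (h : X ⊆ allEdges k n) :
    vset X ⊆ Finset.range n := by
  intro v hv
  obtain ⟨e, he, hv⟩ := mem_vset.1 hv
  exact (Finset.mem_powersetCard.1 (h he)).1 hv

theorem uniform_allEdges {k n : ℕ} {X : Finset (Finset ℕ)} (h : X ⊆ allEdges k n) :
    IsUniform k X := fun _ he => (Finset.mem_powersetCard.1 (h he)).2

/-- graphs that can be attached. -/
noncomputable def attSet (F1 F2 E G D : Finset (Finset ℕ)) : Finset (Finset (Finset ℕ)) :=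
  E.powerset.filter (fun X => IsAttachment F1 F2 X (selE G D) ∧ ¬ X ⊆ G)

theorem att_sum {k n a b s N M : ℕ} {F1 F2 G D : Finset (Finset ℕ)} {x ζ : ℝ}
    (ha : 0 < a) (hb : 0 < b) (hn : 0 < n)
    (hM : ∀ X e, IsAttachment F1 F2 X e → (vset X).card ≤ M)
    (hm : mkA k F1 F2 = (a : ℝ) / b) (hab : AsymBalanced k F1 F2)
    (hx : 0 < x) (hx1 : x ≤ 1) (hζ : 0 < ζ) (hζ1 : ζ ≤ 1)
    (hζn : ζ ^ ((N + 1) * a) = (n : ℝ)⁻¹)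
    (hG : G ⊆ allEdges k n) (hs : G.card ≤ s) (hne : (G \ D).Nonempty) :
    ∑ X ∈ attSet F1 F2 (allEdges k n) G D, wt x ζ N a b (G ∪ X, D) ≤
      wt x ζ N a b (G, D) * (x * (3 * 2 ^ 2 ^ M) +
        ζ * (3 * ((M + 1 : ℕ) * (k * s + 1 : ℕ) ^ M) * 2 ^ 2 ^ M)) := by
  set T := attSet F1 F2 (allEdges k n) G D with hT
  set e := selE G D with he
  have heG : e ∈ G := (Finset.mem_sdiff.1 (selE_mem hne)).1
  have hTm : ∀ X ∈ T, X ⊆ allEdges k n ∧ IsAttachment F1 F2 X e ∧ ¬ X ⊆ G := by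
    intro X hX
    rw [hT, attSet, Finset.mem_filter, Finset.mem_powerset] at hX
    exact hX
  have hn0 : (0 : ℝ) < (n : ℝ)⁻¹ := by
    have : (0 : ℝ) < n := by exact_mod_cast hn
    positivity
  have hstep : ∀ X ∈ T, wt x ζ N a b (G ∪ X, D) ≤ wt x ζ N a b (G, D) *
      ((n : ℝ)⁻¹ ^ (vset X \ vset G).card * (if vset X ∩ vset G = e then x else ζ)) := by
    intro X hX
    obtain ⟨hX1, hX2, hX3⟩ := hTm X hX
    obtain ⟨s1, s2⟩ := step_lemma ha hb hm hab hX2 heG hX3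
    have hpos : 1 ≤ (X \ G).card := by
      rw [Nat.one_le_iff_ne_zero, Finset.card_ne_zero, Finset.sdiff_nonempty]; exact hX3
    have hfac : wt x ζ N a b (G ∪ X, D) = wt x ζ N a b (G, D) *
        (x ^ (X \ G).card * ζ ^ (N * a * (vset X \ vset G).card + b * (X \ G).card)) := by
      unfold wt
      simp only
      rw [card_union', card_vset_union]
      ring
    rw [hfac]
    apply mul_le_mul_of_nonneg_left _ (wt_nonneg hx.le hζ.le _ _ _ _)
    rw [← hζn, ← pow_mul]
    split_ifs with hc
    · rw [mul_comm]
      apply mul_le_mul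
      · apply pow_le_pow_of_le_one hζ.le hζ1
        nlinarith
      · exact pow_le_of_le_one hx.le hx1 (by omega)
      · positivity
      · positivity
    · have s3 := s2.resolve_left hc
      calc x ^ (X \ G).card * ζ ^ (N * a * (vset X \ vset G).card + b * (X \ G).card)
          ≤ 1 * ζ ^ ((N + 1) * a * (vset X \ vset G).card + 1) := by
            apply mul_le_mul
            · exact pow_le_one₀ hx.le hx1
            · apply pow_le_pow_of_le_one hζ.le hζ1
              nlinarith
            · positivity
            · norm_num
        _ = _ := by rw [one_mul, pow_succ]
  refine (Finset.sum_le_sum hstep).trans ?_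
  rw [← Finset.mul_sum]
  apply mul_le_mul_of_nonneg_left _ (wt_nonneg hx.le hζ.le _ _ _ _)
  rw [← Finset.sum_filter_add_sum_filter_not T (fun X => vset X ∩ vset G = e)]
  apply add_le_add
  · calc _ = x * ∑ X ∈ T with vset X ∩ vset G = e, (n : ℝ)⁻¹ ^ (vset X \ vset G).card := by
          rw [Finset.mul_sum]
          apply Finset.sum_congr rfl
          intro X hX
          rw [if_pos (Finset.mem_filter.1 hX).2, mul_comm]
      _ ≤ _ := by
          apply mul_le_mul_of_nonneg_left _ hx.le
          have := count_lemma n M hn (vset G) (T.filter (fun X => vset X ∩ vset G = e)) {e}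
            (fun X hX => vset_allEdges (hTm X (Finset.mem_filter.1 hX).1).1)
            (fun X hX => hM X e (hTm X (Finset.mem_filter.1 hX).1).2.1)
            (fun X hX => by rw [(Finset.mem_filter.1 hX).2]; simp)
          simpa using this
  · calc _ = ζ * ∑ X ∈ T with ¬ (vset X ∩ vset G = e), (n : ℝ)⁻¹ ^ (vset X \ vset G).card := by
          rw [Finset.mul_sum]
          apply Finset.sum_congr rfl
          intro X hX
          rw [if_neg (Finset.mem_filter.1 hX).2, mul_comm]
      _ ≤ _ := by
          apply mul_le_mul_of_nonneg_left _ hζ.le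
          have h1 := count_lemma n M hn (vset G) (T.filter (fun X => ¬ (vset X ∩ vset G = e)))
            ((vset G).powerset.filter (fun Y => Y.card ≤ M))
            (fun X hX => vset_allEdges (hTm X (Finset.mem_filter.1 hX).1).1)
            (fun X hX => hM X e (hTm X (Finset.mem_filter.1 hX).1).2.1)
            (fun X hX => by
              rw [Finset.mem_filter, Finset.mem_powerset]
              exact ⟨Finset.inter_subset_right, (Finset.card_le_card Finset.inter_subset_left).trans
                (hM X e (hTm X (Finset.mem_filter.1 hX).1).2.1)⟩)
          refine h1.trans ?_
          have h2 := card_small_subsets (vset G) M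
          have h3 : (vset G).card ≤ k * s :=
            (card_vset_le (uniform_allEdges hG)).trans (Nat.mul_le_mul_left _ hs)
          have h4 : ((vset G).powerset.filter (fun Y => Y.card ≤ M)).card ≤
              (M + 1) * (k * s + 1) ^ M :=
            h2.trans (Nat.mul_le_mul_left _ (Nat.pow_le_pow_left (by omega) _))
          gcongr
          exact_mod_cast h4

/-- the finite set of reachable states. -/
noncomputable def states (F1 F2 E : Finset (Finset ℕ)) (s : ℕ) :
    Finset (Finset (Finset ℕ) × Finset (Finset ℕ)) :=
  (E.powerset ×ˢ E.powerset).filter (fun σ => Reach F1 F2 E s σ.1 σ.2)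

theorem mem_states {F1 F2 E : Finset (Finset ℕ)} {s : ℕ}
    {σ : Finset (Finset ℕ) × Finset (Finset ℕ)} :
    σ ∈ states F1 F2 E s ↔ Reach F1 F2 E s σ.1 σ.2 := by
  unfold states
  rw [Finset.mem_filter, Finset.mem_product, Finset.mem_powerset, Finset.mem_powerset]
  constructor
  · exact fun h => h.2
  · intro h
    have := reach_sub h
    exact ⟨⟨this.1, this.2.trans this.1⟩, h⟩

theorem states_sum {k n a b s N M : ℕ} {F1 F2 : Finset (Finset ℕ)} {x ζ : ℝ}
    (ha : 0 < a) (hb : 0 < b) (hn : 0 < n)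
    (hM : ∀ X e, IsAttachment F1 F2 X e → (vset X).card ≤ M)
    (hm : mkA k F1 F2 = (a : ℝ) / b) (hab : AsymBalanced k F1 F2)
    (hx : 0 < x) (hx1 : x ≤ 1) (hζ : 0 < ζ) (hζ1 : ζ ≤ 1)
    (hζn : ζ ^ ((N + 1) * a) = (n : ℝ)⁻¹)
    (hsmall : x * (3 * 2 ^ 2 ^ M) +
        ζ * (3 * ((M + 1 : ℕ) * (k * s + 1 : ℕ) ^ M) * 2 ^ 2 ^ M) ≤ 1 / 4) :
    ∑ σ ∈ states F1 F2 (allEdges k n) s, wt x ζ N a b σ ≤ 2 * (n ^ k * ζ ^ (N * a * k)) := by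
  set E := allEdges k n with hE
  set S := states F1 F2 E s with hS
  set S' := S.filter (fun σ => σ.1.card ≤ s ∧ (σ.1 \ σ.2).Nonempty) with hS'
  have hnn := fun σ => wt_nonneg hx.le hζ.le N a b σ
  set nx : Finset (Finset ℕ) × Finset (Finset ℕ) → Finset (Finset (Finset ℕ) × Finset (Finset ℕ)) :=
    fun σ => {(σ.1, insert (selE σ.1 σ.2) σ.2)} ∪
      (attSet F1 F2 E σ.1 σ.2).image (fun X => (σ.1 ∪ X, σ.2)) with hnx
  set I : Finset (Finset (Finset ℕ) × Finset (Finset ℕ)) :=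
    E.image (fun e => (({e} : Finset (Finset ℕ)), (∅ : Finset (Finset ℕ)))) with hI
  have hcov : S ⊆ I ∪ S'.biUnion nx := by
    rintro ⟨G, D⟩ hσ
    have hR : Reach F1 F2 E s G D := mem_states.1 hσ
    cases hR with
    | init e he =>
      apply Finset.mem_union_left
      exact Finset.mem_image.2 ⟨e, he, rfl⟩
    | adv _ D h hs hne =>
      apply Finset.mem_union_right
      refine Finset.mem_biUnion.2 ⟨(G, D), ?_, ?_⟩
      · exact Finset.mem_filter.2 ⟨mem_states.2 h, hs, hne⟩
      · exact Finset.mem_union_left _ (Finset.mem_singleton.2 rfl)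
    | att G _ X h hs hne hX hat hn =>
      apply Finset.mem_union_right
      refine Finset.mem_biUnion.2 ⟨(G, D), ?_, ?_⟩
      · exact Finset.mem_filter.2 ⟨mem_states.2 h, hs, hne⟩
      · apply Finset.mem_union_right
        refine Finset.mem_image.2 ⟨X, ?_, rfl⟩
        exact Finset.mem_filter.2 ⟨Finset.mem_powerset.2 hX, hat, hn⟩
  have hun : ∀ P Q : Finset (Finset (Finset ℕ) × Finset (Finset ℕ)),
      ∑ σ ∈ P ∪ Q, wt x ζ N a b σ ≤ ∑ σ ∈ P, wt x ζ N a b σ + ∑ σ ∈ Q, wt x ζ N a b σ := by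
    intro P Q
    rw [← Finset.sum_union_inter]
    have : 0 ≤ ∑ σ ∈ P ∩ Q, wt x ζ N a b σ := Finset.sum_nonneg (fun σ _ => hnn σ)
    linarith
  have hnext : ∀ σ ∈ S', ∑ τ ∈ nx σ, wt x ζ N a b τ ≤ 1 / 2 * wt x ζ N a b σ := by
    rintro ⟨G, D⟩ hσ
    obtain ⟨h1, h2, h3⟩ := Finset.mem_filter.1 hσ
    simp only at h2 h3
    have hR : Reach F1 F2 E s G D := mem_states.1 h1
    have hsel := (Finset.mem_sdiff.1 (selE_mem h3)).2
    refine (hun _ _).trans ?_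
    have e1 : ∑ σ ∈ {(G, insert (selE G D) D)}, wt x ζ N a b σ = 1 / 4 * wt x ζ N a b (G, D) := by
      rw [Finset.sum_singleton]
      unfold wt
      simp only
      rw [Finset.card_insert_of_notMem hsel]
      ring
    have e2 := (sum_image_le' (attSet F1 F2 E G D) (fun X => (G ∪ X, D)) _ hnn).trans
      (att_sum (N := N) ha hb hn hM hm hab hx hx1 hζ hζ1 hζn (reach_sub hR).1 h2 h3)
    have e3 := e2.trans (mul_le_mul_of_nonneg_left hsmall (hnn (G, D)))
    simp only at e1 e3 ⊢
    rw [e1]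
    linarith
  have hinit : ∑ σ ∈ I, wt x ζ N a b σ ≤ n ^ k * ζ ^ (N * a * k) := by
    refine (sum_image_le' E _ _ hnn).trans ?_
    have : ∀ e ∈ E, wt x ζ N a b ({e}, ∅) ≤ ζ ^ (N * a * k) := by
      intro e he
      unfold wt
      simp only [vset_singleton, Finset.card_singleton, Finset.card_empty, pow_one, pow_zero,
        mul_one]
      rw [(Finset.mem_powersetCard.1 he).2]
      calc x * ζ ^ (N * a * k + b) ≤ 1 * ζ ^ (N * a * k) := by
            apply mul_le_mul hx1 _ (by positivity) (by norm_num)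
            exact pow_le_pow_of_le_one hζ.le hζ1 (by omega)
        _ = _ := one_mul _
    refine (Finset.sum_le_sum this).trans ?_
    rw [Finset.sum_const, nsmul_eq_mul]
    apply mul_le_mul_of_nonneg_right _ (by positivity)
    have : E.card ≤ n ^ k := by
      rw [hE, allEdges, Finset.card_powersetCard, Finset.card_range]
      exact Nat.choose_le_pow _ _
    exact_mod_cast this
  have h1 : ∑ σ ∈ S, wt x ζ N a b σ ≤
      n ^ k * ζ ^ (N * a * k) + 1 / 2 * ∑ σ ∈ S, wt x ζ N a b σ := by
    calc _ ≤ ∑ σ ∈ I ∪ S'.biUnion nx, wt x ζ N a b σ :=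
          Finset.sum_le_sum_of_subset_of_nonneg hcov (fun σ _ _ => hnn σ)
      _ ≤ _ := hun _ _
      _ ≤ n ^ k * ζ ^ (N * a * k) + 1 / 2 * ∑ σ ∈ S, wt x ζ N a b σ := by
          apply add_le_add hinit
          refine (sum_biUnion_le' S' nx _ hnn).trans ?_
          refine (Finset.sum_le_sum hnext).trans ?_
          rw [← Finset.mul_sum]
          apply mul_le_mul_of_nonneg_left _ (by norm_num)
          exact Finset.sum_le_sum_of_subset_of_nonneg (Finset.filter_subset _ _)
            (fun σ _ _ => hnn σ)
  linarith

/-- the main quantitative bound. -/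
theorem prob_bound {k n a b s M : ℕ} {F1 F2 : Finset (Finset ℕ)} {c ζ p : ℝ}
    (ha : 0 < a) (hb : 0 < b) (hn : 0 < n) (h2 : 2 ≤ F2.card)
    (hM : ∀ X e, IsAttachment F1 F2 X e → (vset X).card ≤ M)
    (hm : mkA k F1 F2 = (a : ℝ) / b) (hab : AsymBalanced k F1 F2)
    (hiv : ∀ G : Finset (Finset ℕ), IsUniform k G →
      mDens G ≤ mkA k F1 F2 → ¬ Arrow2 G F1 F2)
    (hc : 0 < c) (hc1 : 16 * c ≤ 1) (hζ : 0 < ζ) (hζ1 : ζ ≤ 1)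
    (hζn : ζ ^ ((a * k + 1 + 1) * a) = (n : ℝ)⁻¹)
    (hsmall : 16 * c * (3 * 2 ^ 2 ^ M) +
        ζ * (3 * ((M + 1 : ℕ) * (k * s + 1 : ℕ) ^ M) * 2 ^ 2 ^ M) ≤ 1 / 4)
    (hp : 0 ≤ p) (hpc : p ≤ c * ζ ^ ((a * k + 1 + 1) * b)) :
    prob k n p (fun G => Arrow2 G F1 F2) ≤ 2 * ζ + 2 * (n ^ k * (1 / 4) ^ s) := by
  set N := a * k + 1 with hN
  set E := allEdges k n with hE
  have hp1 : p ≤ 1 := by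
    have : ζ ^ ((N + 1) * b) ≤ 1 := pow_le_one₀ hζ.le hζ1
    nlinarith
  have hn0 : (0 : ℝ) < n := by exact_mod_cast hn
  have hsum := states_sum (s := s) ha hb hn hM hm hab (by positivity : 0 < 16 * c) hc1 hζ hζ1 hζn hsmall
  set B := (states F1 F2 E s).filter
    (fun σ => s < σ.1.card ∨ a * (vset σ.1).card < b * σ.1.card) with hB
  set κ : ℝ := ζ ^ N + (1 / 4) ^ s * (ζ ^ (N * a * k))⁻¹ with hκ
  have hκ0 : 0 ≤ κ := by positivity
  have hb1 : prob k n p (fun G => Arrow2 G F1 F2) ≤ ∑ σ ∈ B, p ^ σ.1.card := by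
    apply prob_le_sum hp hp1 _ B (fun σ => σ.1)
    · intro σ hσ
      exact (reach_sub (mem_states.1 (Finset.mem_filter.1 hσ).1)).1
    · intro G hG hA
      obtain ⟨S, D, hR, hSG, hbad⟩ := arrow_bad (s := s) ha hb h2 hm hab hiv hG hA
      exact ⟨(S, D), Finset.mem_filter.2 ⟨mem_states.2 hR, hbad⟩, hSG⟩
  have hb2 : ∀ σ ∈ B, p ^ σ.1.card ≤ κ * wt (16 * c) ζ N a b σ := by
    rintro ⟨G, D⟩ hσ
    obtain ⟨hσ1, hσ2⟩ := Finset.mem_filter.1 hσ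
    have hR : Reach F1 F2 E s G D := mem_states.1 hσ1
    have hDG := Finset.card_le_card (reach_sub hR).2
    have hdens := reach_dens ha hb (uniform_allEdges (subset_refl _)) hm hab hR
    simp only at hσ2 ⊢
    have hpow : p ^ G.card ≤ c ^ G.card * ζ ^ ((N + 1) * b * G.card) := by
      calc p ^ G.card ≤ (c * ζ ^ ((N + 1) * b)) ^ G.card := pow_le_pow_left₀ hp hpc _
        _ = _ := by rw [mul_pow, ← pow_mul]
    have hwt : c ^ G.card * ζ ^ (N * a * (vset G).card + b * G.card) * 4 ^ G.card ≤
        wt (16 * c) ζ N a b (G, D) := by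
      unfold wt
      simp only
      have h4 : (1 / 4 : ℝ) ^ G.card ≤ (1 / 4) ^ D.card :=
        pow_le_pow_of_le_one (by norm_num) (by norm_num) hDG
      calc _ = (16 * c) ^ G.card * ζ ^ (N * a * (vset G).card + b * G.card) * (1 / 4) ^ G.card := by
            have : (16 * c) ^ G.card = c ^ G.card * 4 ^ G.card * 4 ^ G.card := by
              rw [← mul_pow, ← mul_pow]; congr 1; ring
            have h44 : (4 : ℝ) ^ G.card * (1 / 4) ^ G.card = 1 := by
              rw [← mul_pow]; norm_num
            rw [this]
            linear_combination (-(c ^ G.card * ζ ^ (N * a * (vset G).card + b * G.card) * 4 ^ G.card)) * h44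
        _ ≤ _ := by gcongr
    refine hpow.trans ?_
    rcases hσ2 with hl | hl
    · have h5 : ζ ^ ((N + 1) * b * G.card) * ζ ^ (N * a * k) ≤
          ζ ^ (N * a * (vset G).card + b * G.card) := by
        rw [← pow_add]
        apply pow_le_pow_of_le_one hζ.le hζ1
        nlinarith
      have h6 : (1 / 4 : ℝ) ^ s * 4 ^ G.card ≥ 1 := by
        have : (4 : ℝ) ^ s ≤ 4 ^ G.card := pow_le_pow_right₀ (by norm_num) hl.le
        have h7 : (1 / 4 : ℝ) ^ s * 4 ^ s = 1 := by rw [← mul_pow]; norm_num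
        have h9 := mul_le_mul_of_nonneg_left this (by positivity : (0 : ℝ) ≤ (1 / 4) ^ s)
        linarith
      have hz : 0 < ζ ^ (N * a * k) := by positivity
      have h8 : ζ ^ ((N + 1) * b * G.card) ≤
          ζ ^ (N * a * (vset G).card + b * G.card) * (ζ ^ (N * a * k))⁻¹ := by
        rw [← div_eq_mul_inv, le_div_iff₀ hz]; exact h5
      calc c ^ G.card * ζ ^ ((N + 1) * b * G.card)
          ≤ c ^ G.card * (ζ ^ (N * a * (vset G).card + b * G.card) * (ζ ^ (N * a * k))⁻¹) * 1 := by
            rw [mul_one]; gcongr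
        _ ≤ c ^ G.card * (ζ ^ (N * a * (vset G).card + b * G.card) * (ζ ^ (N * a * k))⁻¹) *
              ((1 / 4 : ℝ) ^ s * 4 ^ G.card) := by gcongr
        _ = ((1 / 4 : ℝ) ^ s * (ζ ^ (N * a * k))⁻¹) *
              (c ^ G.card * ζ ^ (N * a * (vset G).card + b * G.card) * 4 ^ G.card) := by ring
        _ ≤ κ * wt (16 * c) ζ N a b (G, D) := by
            apply mul_le_mul _ hwt (by positivity) hκ0
            rw [hκ]
            have : 0 ≤ ζ ^ N := by positivity
            linarith
    · have h5 : ζ ^ ((N + 1) * b * G.card) ≤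
          ζ ^ (N * a * (vset G).card + b * G.card) * ζ ^ N := by
        rw [← pow_add]
        apply pow_le_pow_of_le_one hζ.le hζ1
        nlinarith
      have h6 : (1 : ℝ) ≤ 4 ^ G.card := one_le_pow₀ (by norm_num)
      calc c ^ G.card * ζ ^ ((N + 1) * b * G.card)
          ≤ c ^ G.card * (ζ ^ (N * a * (vset G).card + b * G.card) * ζ ^ N) * 1 := by
            rw [mul_one]; gcongr
        _ ≤ c ^ G.card * (ζ ^ (N * a * (vset G).card + b * G.card) * ζ ^ N) * 4 ^ G.card := by
            gcongr
        _ = ζ ^ N * (c ^ G.card * ζ ^ (N * a * (vset G).card + b * G.card) * 4 ^ G.card) := by ring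
        _ ≤ κ * wt (16 * c) ζ N a b (G, D) := by
            apply mul_le_mul _ hwt (by positivity) hκ0
            rw [hκ]
            have : 0 ≤ (1 / 4 : ℝ) ^ s * (ζ ^ (N * a * k))⁻¹ := by positivity
            linarith
  have hz : 0 < ζ ^ (N * a * k) := by positivity
  have hnk : (n : ℝ) ^ k * ζ ^ (N * a * k) * ζ ^ (a * k) = 1 := by
    rw [mul_assoc, ← pow_add]
    have : N * a * k + a * k = (N + 1) * a * k := by ring
    rw [this, pow_mul, hζn, ← mul_pow, mul_inv_cancel₀ hn0.ne', one_pow]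
  calc prob k n p (fun G => Arrow2 G F1 F2) ≤ ∑ σ ∈ B, p ^ σ.1.card := hb1
    _ ≤ ∑ σ ∈ B, κ * wt (16 * c) ζ N a b σ := Finset.sum_le_sum hb2
    _ ≤ ∑ σ ∈ states F1 F2 E s, κ * wt (16 * c) ζ N a b σ :=
        Finset.sum_le_sum_of_subset_of_nonneg (Finset.filter_subset _ _)
          (fun σ _ _ => mul_nonneg hκ0 (wt_nonneg (by positivity) hζ.le _ _ _ _))
    _ = κ * ∑ σ ∈ states F1 F2 E s, wt (16 * c) ζ N a b σ := by rw [Finset.mul_sum]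
    _ ≤ κ * (2 * (n ^ k * ζ ^ (N * a * k))) := mul_le_mul_of_nonneg_left hsum hκ0
    _ = 2 * ζ + 2 * (n ^ k * (1 / 4) ^ s) := by
        have h1 : ζ ^ N = ζ ^ (a * k) * ζ := by rw [hN, pow_succ]
        have h2 : (ζ ^ (N * a * k))⁻¹ * ζ ^ (N * a * k) = 1 := inv_mul_cancel₀ hz.ne'
        rw [hκ, h1]
        linear_combination 2 * ζ * hnk + 2 * (n : ℝ) ^ k * (1 / 4) ^ s * h2


theorem arrow_arrow2 {k r : ℕ} (hr : 2 ≤ r) (F : Fin r → Finset (Finset ℕ))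
    (hpos : ∀ i, 0 < mk k (F i)) (G : Finset (Finset ℕ)) (h : Arrow G F) :
    Arrow2 G (F ⟨0, by omega⟩) (F ⟨1, by omega⟩) := by
  intro χ
  obtain ⟨i, F', hF', hc, hm⟩ := h (fun e => ⟨(χ e).val, by have := (χ e).isLt; omega⟩)
  have hne : F'.Nonempty := by
    obtain ⟨f, -, rfl⟩ := hc
    exact (mk_pos_nonempty (hpos i)).image _
  obtain ⟨e, he⟩ := hne
  have hi := hm e he
  have h01 : χ e = 0 ∨ χ e = 1 := by
    generalize χ e = y
    fin_cases y <;> simp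
  rcases h01 with h0 | h0
  · left
    have hi0 : i = ⟨0, Nat.lt_of_lt_of_le (by norm_num) hr⟩ := by
      rw [← hi]; apply Fin.ext; simp [h0]
    rw [hi0] at hc
    clear hi
    rw [hi0] at hm
    refine ⟨F', hF', hc, fun e' he' => ?_⟩
    have := congrArg Fin.val (hm e' he')
    apply Fin.ext
    simpa using this
  · right
    have hi0 : i = ⟨1, Nat.lt_of_lt_of_le (by norm_num) hr⟩ := by
      rw [← hi]; apply Fin.ext; simp [h0]
    rw [hi0] at hc
    clear hi
    rw [hi0] at hm
    refine ⟨F', hF', hc, fun e' he' => ?_⟩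
    have := congrArg Fin.val (hm e' he')
    apply Fin.ext
    simpa using this

theorem prob_mono {k n : ℕ} {p : ℝ} (hp : 0 ≤ p) (hp1 : p ≤ 1)
    (P Q : Finset (Finset ℕ) → Prop) (h : ∀ G, P G → Q G) : prob k n p P ≤ prob k n p Q := by
  apply Finset.sum_le_sum
  intro G _
  have hq : 0 ≤ 1 - p := by linarith
  by_cases hP : P G
  · rw [if_pos hP, if_pos (h G hP)]
  · rw [if_neg hP]
    split_ifs
    · positivity
    · exact le_rfl

/-- the size threshold. -/
noncomputable def sz (k n : ℕ) : ℕ := ⌈((k : ℝ) + 1) * Real.log n⌉₊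

theorem sz_bigO (k : ℕ) :
    (fun n : ℕ => ((k * sz k n + 1 : ℕ) : ℝ)) =O[Filter.atTop] (fun n : ℕ => Real.log n) := by
  apply Asymptotics.IsBigO.of_bound ((k : ℝ) * (k + 2) + 1)
  filter_upwards [Filter.eventually_ge_atTop 3] with n hn
  have h3 : (3 : ℝ) ≤ n := by exact_mod_cast hn
  have hl : 1 ≤ Real.log n := by
    rw [Real.le_log_iff_exp_le (by linarith)]
    have := Real.exp_one_lt_d9
    linarith
  have hs : (sz k n : ℝ) ≤ ((k : ℝ) + 1) * Real.log n + 1 :=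
    (Nat.ceil_lt_add_one (by positivity)).le
  rw [Real.norm_of_nonneg (by positivity), Real.norm_of_nonneg (by linarith)]
  push_cast
  have hk : (0 : ℝ) ≤ k := by positivity
  nlinarith

theorem small_tendsto (k M : ℕ) {ε : ℝ} (hε : 0 < ε) (A B : ℝ) :
    Filter.Tendsto (fun n : ℕ => (n : ℝ) ^ (-ε) * (3 * (A * ((k * sz k n + 1 : ℕ) : ℝ) ^ M) * B))
      Filter.atTop (nhds 0) := by
  have h1 := (sz_bigO k).pow M
  have h2 : (fun x : ℝ => Real.log x ^ (M : ℝ)) =o[Filter.atTop] (fun x : ℝ => x ^ ε) :=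
    isLittleO_log_rpow_rpow_atTop (M : ℝ) hε
  have h3 := h2.comp_tendsto (tendsto_natCast_atTop_atTop (R := ℝ))
  have h4 : (fun n : ℕ => ((k * sz k n + 1 : ℕ) : ℝ) ^ M) =o[Filter.atTop]
      (fun n : ℕ => (n : ℝ) ^ ε) := by
    refine h1.trans_isLittleO ?_
    simpa [Function.comp_def, Real.rpow_natCast] using h3
  have h5 := (h4.tendsto_div_nhds_zero).const_mul (3 * A * B)
  rw [mul_zero] at h5
  refine h5.congr (fun n => ?_)
  rw [Real.rpow_neg (by positivity)]
  rw [div_eq_mul_inv]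
  ring

theorem sz_pow {k n : ℕ} (hn : 0 < n) : (n : ℝ) ^ k * (1 / 4) ^ sz k n ≤ (n : ℝ)⁻¹ := by
  have hn0 : (0 : ℝ) < n := by exact_mod_cast hn
  have h1 : (n : ℝ) ^ (k + 1) ≤ 4 ^ sz k n := by
    calc (n : ℝ) ^ (k + 1) = Real.exp (((k : ℝ) + 1) * Real.log n) := by
          rw [mul_comm, Real.exp_mul, Real.exp_log hn0]
          rw [← Nat.cast_add_one, Real.rpow_natCast]
      _ ≤ Real.exp (sz k n) := Real.exp_le_exp.2 (Nat.le_ceil _)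
      _ = Real.exp 1 ^ sz k n := by rw [← Real.exp_nat_mul, mul_one]
      _ ≤ 4 ^ sz k n := by
          apply pow_le_pow_left₀ (Real.exp_pos _).le
          have := Real.exp_one_lt_d9
          linarith
  rw [one_div, inv_pow, ← div_eq_mul_inv, div_le_iff₀ (by positivity), inv_mul_eq_div,
    le_div_iff₀ hn0, ← pow_succ]
  exact h1

/-- the 0-statement for asymmetric Ramsey properties, under the
balancedness conditions (i)–(iv). -/
theorem asymmetric_zero_statement (k r : ℕ) (hk : 1 ≤ k) (hr : 2 ≤ r)
    (F : Fin r → Finset (Finset ℕ))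
    (hu : ∀ i, IsUniform k (F i))
    (h3 : 3 ≤ (F ⟨1, by omega⟩).card)
    (hmono : ∀ i j : Fin r, i ≤ j → mk k (F j) ≤ mk k (F i))
    (hpos : ∀ i, 0 < mk k (F i))
    (hbal1 : StrictlyKBalanced k (F ⟨0, by omega⟩))
    (hbal2 : StrictlyKBalanced k (F ⟨1, by omega⟩))
    (hge1 : 1 ≤ mk k (F ⟨1, by omega⟩))
    (hsb : StrictlyBalancedWrt k (F ⟨0, by omega⟩) (F ⟨1, by omega⟩))
    (hab : AsymBalanced k (F ⟨0, by omega⟩) (F ⟨1, by omega⟩))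
    (hiv : ∀ G : Finset (Finset ℕ), IsUniform k G →
      mDens G ≤ mkA k (F ⟨0, by omega⟩) (F ⟨1, by omega⟩) →
      ¬ Arrow2 G (F ⟨0, by omega⟩) (F ⟨1, by omega⟩)) :
    ∃ c : ℝ, 0 < c ∧ ∀ p : ℕ → ℝ,
      (∀ n : ℕ, 0 ≤ p n ∧
        p n ≤ c * (n : ℝ) ^ (-(1 / mkA k (F ⟨0, by omega⟩) (F ⟨1, by omega⟩)))) →
      Filter.Tendsto (fun n : ℕ => prob k n (p n) (fun G => Arrow G F))
        Filter.atTop (nhds 0) := by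
  have hne1 := mk_pos_nonempty (hpos ⟨0, by omega⟩)
  obtain ⟨a, b, ha, hb, hm⟩ := mkA_rat (hu ⟨0, by omega⟩) hne1 (hpos ⟨1, by omega⟩)
  have hAr := arrow_arrow2 hr F hpos
  have hM : ∀ X e, IsAttachment (F ⟨0, by omega⟩) (F ⟨1, by omega⟩) X e → (vset X).card ≤ _ :=
    fun X e h => attach_bound (hu ⟨0, by omega⟩) (hu ⟨1, by omega⟩) h
  generalize k * ((F ⟨1, by omega⟩).card +
    (F ⟨1, by omega⟩).card * (F ⟨0, by omega⟩).card) = M at hM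
  generalize F ⟨0, by omega⟩ = F1 at *
  generalize F ⟨1, by omega⟩ = F2 at *
  have hK : (1 : ℝ) ≤ 2 ^ 2 ^ M := one_le_pow₀ (by norm_num)
  have hc : (0 : ℝ) < 1 / (16 * 24 * 2 ^ 2 ^ M) := by positivity
  refine ⟨1 / (16 * 24 * 2 ^ 2 ^ M), hc, ?_⟩
  have hcK : 16 * (1 / (16 * 24 * 2 ^ 2 ^ M)) * (3 * 2 ^ 2 ^ M) = (1 / 8 : ℝ) := by
    field_simp; norm_num
  set c : ℝ := 1 / (16 * 24 * 2 ^ 2 ^ M) with hcdef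
  have hc1 : 16 * c ≤ 1 := by nlinarith
  intro p hp
  have ha' : (0 : ℝ) < a := by exact_mod_cast ha
  have hb' : (0 : ℝ) < b := by exact_mod_cast hb
  set ε : ℝ := 1 / (((a * k + 1 + 1 : ℕ) : ℝ) * a) with hε
  have hN0 : (0 : ℝ) < ((a * k + 1 + 1 : ℕ) : ℝ) := by positivity
  have hε0 : 0 < ε := by positivity
  have hpow : ∀ n : ℕ, ∀ j : ℕ, ((n : ℝ) ^ (-ε)) ^ j = (n : ℝ) ^ (-ε * j) := by
    intro n j
    rw [Real.rpow_mul (by positivity), Real.rpow_natCast]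
  have hsm := small_tendsto k M hε0 ((M + 1 : ℕ) : ℝ) (2 ^ 2 ^ M)
  have hev := hsm.eventually (ge_mem_nhds (by norm_num : (0 : ℝ) < 1 / 8))
  have hzt : Filter.Tendsto (fun n : ℕ => (n : ℝ) ^ (-ε)) Filter.atTop (nhds 0) :=
    (tendsto_rpow_neg_atTop hε0).comp (tendsto_natCast_atTop_atTop (R := ℝ))
  have hlim : Filter.Tendsto (fun n : ℕ => 2 * (n : ℝ) ^ (-ε) + 2 * (n : ℝ)⁻¹)
      Filter.atTop (nhds 0) := by
    have := (hzt.const_mul 2).add ((tendsto_inv_atTop_nhds_zero_nat (𝕜 := ℝ)).const_mul 2)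
    simpa using this
  have key : ∀ᶠ n : ℕ in Filter.atTop, 0 ≤ prob k n (p n) (fun G => Arrow G F) ∧
      prob k n (p n) (fun G => Arrow G F) ≤ 2 * (n : ℝ) ^ (-ε) + 2 * (n : ℝ)⁻¹ := by
    filter_upwards [hev, Filter.eventually_gt_atTop 0] with n hn1 hn
    have hn0 : (1 : ℝ) ≤ n := by exact_mod_cast hn
    have hζ : 0 < (n : ℝ) ^ (-ε) := Real.rpow_pos_of_pos (by linarith) _
    have hζ1 : (n : ℝ) ^ (-ε) ≤ 1 := Real.rpow_le_one_of_one_le_of_nonpos hn0 (by linarith)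
    have hζn : ((n : ℝ) ^ (-ε)) ^ ((a * k + 1 + 1) * a) = (n : ℝ)⁻¹ := by
      rw [hpow, ← Real.rpow_neg_one]
      congr 1
      rw [hε, Nat.cast_mul]
      field_simp
    have hpc : p n ≤ c * ((n : ℝ) ^ (-ε)) ^ ((a * k + 1 + 1) * b) := by
      refine (hp n).2.trans (le_of_eq ?_)
      rw [hpow, hm]
      congr 2
      rw [hε, Nat.cast_mul]
      field_simp
    have hp1 : p n ≤ 1 := by
      have : ((n : ℝ) ^ (-ε)) ^ ((a * k + 1 + 1) * b) ≤ 1 := pow_le_one₀ hζ.le hζ1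
      nlinarith
    refine ⟨prob_nonneg (hp n).1 hp1 _, ?_⟩
    refine (prob_mono (hp n).1 hp1 _ _ hAr).trans ?_
    have hmain := prob_bound (k := k) (n := n) (s := sz k n) ha hb hn (by omega) hM hm hab hiv hc hc1
      hζ hζ1 hζn (by rw [hcK]; linarith) (hp n).1 hpc
    have := sz_pow (k := k) hn
    linarith
  exact tendsto_of_tendsto_of_tendsto_of_le_of_le' tendsto_const_nhds hlim
    (key.mono fun n h => h.1) (key.mono fun n h => h.2)

end ARR
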